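/- arXiv:1412.7414 — 6 statements merged into one kernel-verified Lean document; each statement's English description precedes it below -/
import Mathlib

section
/- Let A, B, C, D be four pairwise distinct points of the Euclidean plane with B ≠ D, such that the (undirected) angle ∠ A B C = π/2 and ∠ A D C = π/2 (a diametral quadrilateral with right angles at the opposite vertices B and D). Let A⋆ and C⋆ be the orthogonal projections of A and C, respectively, onto the line through B and D. Then the midpoint of the segment B D equals the midpoint of the segment A⋆ C⋆. -/
open EuclideanGeometry Real

/-- The orthogonal projection onto an affine subspace preserves midpoints. -/
theorem midpoint_coe_orthogonalProjection {V P : Type*} [NormedAddCommGroup V]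
    [InnerProductSpace ℝ V] [MetricSpace P] [NormedAddTorsor V P] (s : AffineSubspace ℝ P)
    [Nonempty s] [s.direction.HasOrthogonalProjection] (p q : P) :
    midpoint ℝ (EuclideanGeometry.orthogonalProjection s p : P)
        (EuclideanGeometry.orthogonalProjection s q) =
      EuclideanGeometry.orthogonalProjection s (midpoint ℝ p q) :=
  ((s.subtype.comp (EuclideanGeometry.orthogonalProjection s).toAffineMap).map_midpoint
    p q).symm

/-- If `B` and `D` both see the segment `AC` at a right angle, the segment joining the midpoints
of `BD` and `AC` is perpendicular to `BD`. -/
theorem inner_sub_midpoint_sub_midpoint_eq_zero {V : Type*} [NormedAddCommGroup V]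
    [InnerProductSpace ℝ V] {A B C D : V} (hB : ∠ A B C = π / 2) (hD : ∠ A D C = π / 2) :
    inner ℝ (D - B) (midpoint ℝ A C - midpoint ℝ B D) = 0 := by
  rw [EuclideanGeometry.angle, ← InnerProductGeometry.inner_eq_zero_iff_angle_eq_pi_div_two,
    vsub_eq_sub, vsub_eq_sub] at hB hD
  simp only [midpoint_eq_smul_add, ← smul_sub, inner_smul_right, inner_sub_left, inner_sub_right,
    inner_add_right] at hB hD ⊢
  rw [real_inner_comm A B, real_inner_comm A D, real_inner_comm B D]
  simp only [invOf_eq_inv]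
  linarith

theorem diametral_quadrilateral_midpoint
    (A B C D : EuclideanSpace ℝ (Fin 2))
    (hAB : A ≠ B) (hAC : A ≠ C) (hAD : A ≠ D) (hBC : B ≠ C) (hBD : B ≠ D) (hCD : C ≠ D)
    (hB : ∠ A B C = π / 2) (hD : ∠ A D C = π / 2)
    (Astar Cstar : EuclideanSpace ℝ (Fin 2))
    (hAstar : Astar = EuclideanGeometry.orthogonalProjection (affineSpan ℝ {B, D}) A)
    (hCstar : Cstar = EuclideanGeometry.orthogonalProjection (affineSpan ℝ {B, D}) C) :
    midpoint ℝ B D = midpoint ℝ Astar Cstar := by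
  rw [hAstar, hCstar, midpoint_coe_orthogonalProjection, eq_comm,
    coe_orthogonalProjection_eq_iff_mem]
  refine ⟨AffineMap.lineMap_mem_affineSpan_pair _ _ _, ?_⟩
  rw [direction_affineSpan, vectorSpan_pair_rev, Submodule.mem_orthogonal_singleton_iff_inner_right]
  exact inner_sub_midpoint_sub_midpoint_eq_zero hB hD
end

section
/- (Hyperbolic case of the diametral quadrilateral theorem, in the hyperboloid model.) Let Q(x,y) = x₀y₀ − x₁y₁ − x₂y₂ be the Minkowski bilinear form on ℝ³, and let A, B, C, D be points of the hyperboloid (Q(X,X) = 1 and X₀ > 0) with B ≠ D, satisfying the right-angle conditions Q(A,C) = Q(A,B)·Q(B,C) and Q(A,C) = Q(A,D)·Q(D,C) (the quadrilateral ABCD has right angles at B and at D). Let A⋆ be a point of the hyperboloid lying in span{B,D} such that Q(A,v) = 0 for every v ∈ span{B,D} with Q(v,A⋆) = 0 (the foot of the perpendicular from A to the hyperbolic line BD), and let C⋆ be the analogous foot of the perpendicular from C. Let M be a point of the hyperboloid lying in span{B,D} with Q(M,B) = Q(M,D) (the midpoint of B and D). Then Q(M,A⋆) = Q(M,C⋆);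 that is, M is also the midpoint of A⋆ and C⋆. -/
/-- The Minkowski bilinear form on `ℝ³`. -/
def minkQ (x y : Fin 3 → ℝ) : ℝ := x 0 * y 0 - x 1 * y 1 - x 2 * y 2

/-- A point of the hyperboloid model of the hyperbolic plane. -/
def IsHyperboloidPoint (X : Fin 3 → ℝ) : Prop := minkQ X X = 1 ∧ 0 < X 0

lemma minkQ_comm (x y : Fin 3 → ℝ) : minkQ x y = minkQ y x := by
  simp only [minkQ]; ring

lemma minkQ_smul_add_smul_right (x y z : Fin 3 → ℝ) (a b : ℝ) :
    minkQ x (a • y + b • z) = a * minkQ x y + b * minkQ x z := by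
  simp only [minkQ, Pi.add_apply, Pi.smul_apply, smul_eq_mul]; ring

lemma minkQ_smul_add_smul_left (x y z : Fin 3 → ℝ) (a b : ℝ) :
    minkQ (a • y + b • z) x = a * minkQ y x + b * minkQ z x := by
  simp only [minkQ, Pi.add_apply, Pi.smul_apply, smul_eq_mul]; ring

/-- Reversed Cauchy–Schwarz inequality on the hyperboloid, with its equality case. -/
lemma IsHyperboloidPoint.one_lt_minkQ {X Y : Fin 3 → ℝ} (hX : IsHyperboloidPoint X)
    (hY : IsHyperboloidPoint Y) (hXY : X ≠ Y) : 1 < minkQ X Y := by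
  obtain ⟨hX1, hX0⟩ := hX
  obtain ⟨hY1, hY0⟩ := hY
  simp only [minkQ] at *
  by_contra! hle
  have hpos : 0 < X 0 * Y 0 := mul_pos hX0 hY0
  have hsq : (X 0 * Y 0) ^ 2 ≤ (1 + X 1 * Y 1 + X 2 * Y 2) ^ 2 :=
    pow_le_pow_left₀ hpos.le (by linarith) 2
  have hid : (X 0 * Y 0) ^ 2 - (1 + X 1 * Y 1 + X 2 * Y 2) ^ 2 =
      (X 1 - Y 1) ^ 2 + (X 2 - Y 2) ^ 2 + (X 1 * Y 2 - X 2 * Y 1) ^ 2 := by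
    have hX2 : X 0 ^ 2 = 1 + X 1 ^ 2 + X 2 ^ 2 := by linarith
    have hY2 : Y 0 ^ 2 = 1 + Y 1 ^ 2 + Y 2 ^ 2 := by linarith
    rw [mul_pow, hX2, hY2]; ring
  have h1 : X 1 = Y 1 := by
    nlinarith [sq_nonneg (X 1 - Y 1), sq_nonneg (X 2 - Y 2),
      sq_nonneg (X 1 * Y 2 - X 2 * Y 1)]
  have h2 : X 2 = Y 2 := by
    nlinarith [sq_nonneg (X 1 - Y 1), sq_nonneg (X 2 - Y 2),
      sq_nonneg (X 1 * Y 2 - X 2 * Y 1)]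
  have h0 : X 0 = Y 0 := by
    rw [h1, h2] at hX1
    nlinarith
  exact hXY (by ext i; fin_cases i <;> assumption)

lemma IsHyperboloidPoint.minkQ_pos {X Y : Fin 3 → ℝ} (hX : IsHyperboloidPoint X)
    (hY : IsHyperboloidPoint Y) : 0 < minkQ X Y := by
  by_cases h : X = Y
  · rw [← h, hX.1]; exact one_pos
  · linarith [hX.one_lt_minkQ hY h]

/-- On a subspace `S`, pairing with a point `Z` is proportional to pairing with the foot `F`
of the perpendicular from `Z`. -/
lemma minkQ_eq_mul_of_foot {S : Submodule ℝ (Fin 3 → ℝ)} {Z F v : Fin 3 → ℝ}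
    (hF : minkQ F F = 1) (hFS : F ∈ S) (hfoot : ∀ v ∈ S, minkQ v F = 0 → minkQ Z v = 0)
    (hv : v ∈ S) : minkQ Z v = minkQ Z F * minkQ F v := by
  have h := hfoot ((1 : ℝ) • v + (-minkQ F v) • F)
    (S.add_mem (S.smul_mem _ hv) (S.smul_mem _ hFS))
    (by rw [minkQ_smul_add_smul_left, hF, minkQ_comm v F]; ring)
  rw [minkQ_smul_add_smul_right] at h
  linarith

/-- Two points `E`, `F` of a hyperbolic line `BD` whose pairings with `B` and with `D` have equal
products are symmetric about the midpoint of `BD`. -/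
lemma minkQ_add_minkQ_eq_of_mul_eq {B D E F : Fin 3 → ℝ}
    (hB : IsHyperboloidPoint B) (hD : IsHyperboloidPoint D) (hBD : B ≠ D)
    (hE : IsHyperboloidPoint E) (hF : IsHyperboloidPoint F)
    (hEmem : E ∈ Submodule.span ℝ ({B, D} : Set (Fin 3 → ℝ)))
    (hFmem : F ∈ Submodule.span ℝ ({B, D} : Set (Fin 3 → ℝ)))
    (h : minkQ E B * minkQ F B = minkQ E D * minkQ F D) :
    minkQ E B + minkQ E D = minkQ F B + minkQ F D := by
  have hk := hB.one_lt_minkQ hD hBD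
  have hEB := hE.minkQ_pos hB
  have hED := hE.minkQ_pos hD
  have hFB := hF.minkQ_pos hB
  have hFD := hF.minkQ_pos hD
  have hE1 := hE.1
  have hF1 := hF.1
  obtain ⟨p, q, rfl⟩ := Submodule.mem_span_pair.1 hEmem
  obtain ⟨r, s, rfl⟩ := Submodule.mem_span_pair.1 hFmem
  simp only [minkQ_smul_add_smul_left, minkQ_smul_add_smul_right, hB.1, hD.1,
    minkQ_comm D B] at *
  set k := minkQ B D
  have hprqs : p * r = q * s := by
    have h0 : (k ^ 2 - 1) * (p * r - q * s) = 0 := by linear_combination -h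
    have hk2 : k ^ 2 - 1 ≠ 0 := by nlinarith
    linarith [(mul_eq_zero.1 h0).resolve_left hk2]
  have hsq : (p + q) ^ 2 = (r + s) ^ 2 := by
    linear_combination (r + s) ^ 2 * hE1 - (p + q) ^ 2 * hF1
      - 2 * (k - 1) * (q * r - p * s) * hprqs
  have hpq : 0 < p + q := by
    by_contra! hneg
    nlinarith
  have hrs : 0 < r + s := by
    by_contra! hneg
    nlinarith
  have hsum : p + q = r + s := (sq_eq_sq₀ hpq.le hrs.le).1 hsq
  linear_combination (1 + k) * hsum

/-- The midpoint of `B` and `D` is a multiple of `B + D`. -/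
lemma exists_eq_smul_add_smul_of_midpoint {B D M : Fin 3 → ℝ}
    (hB : IsHyperboloidPoint B) (hD : IsHyperboloidPoint D) (hBD : B ≠ D)
    (hMmem : M ∈ Submodule.span ℝ ({B, D} : Set (Fin 3 → ℝ)))
    (hMmid : minkQ M B = minkQ M D) : ∃ m : ℝ, M = m • B + m • D := by
  have hk := hB.one_lt_minkQ hD hBD
  obtain ⟨m, n, rfl⟩ := Submodule.mem_span_pair.1 hMmem
  simp only [minkQ_smul_add_smul_left, hB.1, hD.1, minkQ_comm D B] at hMmid
  have h0 : (minkQ B D - 1) * (m - n) = 0 := by linear_combination -hMmid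
  have hmn : m = n := sub_eq_zero.1 ((mul_eq_zero.1 h0).resolve_left (by linarith))
  exact ⟨m, by rw [hmn]⟩

theorem diametral_quadrilateral_midpoint_hyperbolic
    (A B C D : Fin 3 → ℝ)
    (hA : IsHyperboloidPoint A) (hB : IsHyperboloidPoint B)
    (hC : IsHyperboloidPoint C) (hD : IsHyperboloidPoint D)
    (hBD : B ≠ D)
    (hrB : minkQ A C = minkQ A B * minkQ B C)
    (hrD : minkQ A C = minkQ A D * minkQ D C)
    (Astar : Fin 3 → ℝ) (hAstarH : IsHyperboloidPoint Astar)
    (hAstarMem : Astar ∈ Submodule.span ℝ ({B, D} : Set (Fin 3 → ℝ)))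
    (hAstarFoot : ∀ v ∈ Submodule.span ℝ ({B, D} : Set (Fin 3 → ℝ)),
      minkQ v Astar = 0 → minkQ A v = 0)
    (Cstar : Fin 3 → ℝ) (hCstarH : IsHyperboloidPoint Cstar)
    (hCstarMem : Cstar ∈ Submodule.span ℝ ({B, D} : Set (Fin 3 → ℝ)))
    (hCstarFoot : ∀ v ∈ Submodule.span ℝ ({B, D} : Set (Fin 3 → ℝ)),
      minkQ v Cstar = 0 → minkQ C v = 0)
    (M : Fin 3 → ℝ) (hM : IsHyperboloidPoint M)
    (hMmem : M ∈ Submodule.span ℝ ({B, D} : Set (Fin 3 → ℝ)))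
    (hMmid : minkQ M B = minkQ M D) :
    minkQ M Astar = minkQ M Cstar := by
  have hBS : B ∈ Submodule.span ℝ ({B, D} : Set (Fin 3 → ℝ)) :=
    Submodule.subset_span (by simp)
  have hDS : D ∈ Submodule.span ℝ ({B, D} : Set (Fin 3 → ℝ)) :=
    Submodule.subset_span (by simp)
  have hα := hA.minkQ_pos hAstarH
  have hγ := hC.minkQ_pos hCstarH
  have hprod : minkQ Astar B * minkQ Cstar B = minkQ Astar D * minkQ Cstar D := by
    have h := hrB.symm.trans hrD
    rw [minkQ_comm B C, minkQ_comm D C,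
      minkQ_eq_mul_of_foot hAstarH.1 hAstarMem hAstarFoot hBS,
      minkQ_eq_mul_of_foot hAstarH.1 hAstarMem hAstarFoot hDS,
      minkQ_eq_mul_of_foot hCstarH.1 hCstarMem hCstarFoot hBS,
      minkQ_eq_mul_of_foot hCstarH.1 hCstarMem hCstarFoot hDS] at h
    refine mul_left_cancel₀ (mul_pos hα hγ).ne' ?_
    linear_combination h
  have hsum := minkQ_add_minkQ_eq_of_mul_eq hB hD hBD hAstarH hCstarH hAstarMem hCstarMem hprod
  obtain ⟨m, rfl⟩ := exists_eq_smul_add_smul_of_midpoint hB hD hBD hMmem hMmid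
  rw [minkQ_comm _ Astar, minkQ_comm _ Cstar, minkQ_smul_add_smul_right,
    minkQ_smul_add_smul_right]
  linear_combination m * hsum
end

section
/- (Projective version of the diametral quadrilateral theorem.) Let Q be a nondegenerate symmetric bilinear form on ℝ³. Let a, b, c, d be nonzero vectors representing a complete quadrangle in general position with respect to the conic Q = 0: assume b and d are linearly independent, a ∉ span{b,d}, c ∉ span{b,d}, and the restriction of Q to span{b,d} is nondegenerate. Assume the line ab is conjugate to the line bc (i.e. every nonzero p with Q(p,a) = Q(p,b) = 0 lies in span{b,c}) and the line ad is conjugate to the line dc (i.e. every nonzero p with Q(p,a) = Q(p,d) = 0 lies in span{d,c}). Let a′ be a nonzero vector with Q(a′,b) = Q(a′,d) = 0 (the pole of the line bd), and let A⋆ be a nonzero vector in span{a,a′} ∩ span{b,d} and C⋆ a nonzero vector in span{c,a′} ∩ span{b,d}. Let m₁, m₂ be linearly independent vectors in span{b,d} with Q(m₁,m₂) = 0 and harmonic with respect to b, d, i.e. m₁ = β·b + δ·d and m₂ = β′·b + δ′·d with β·δ′ + β′·δ = 0. Then A⋆ and C⋆ are harmonic with respect to m₁, m₂: writing A⋆ =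 σ·m₁ + τ·m₂ and C⋆ = σ′·m₁ + τ′·m₂, one has σ·τ′ + σ′·τ = 0. -/
/-- Any two vectors of a three-dimensional space admit a common nonzero orthogonal vector. -/
theorem exists_ne_zero_bilinForm_eq_zero (Q : LinearMap.BilinForm ℝ (Fin 3 → ℝ))
    (x y : Fin 3 → ℝ) : ∃ p, p ≠ 0 ∧ Q p x = 0 ∧ Q p y = 0 := by
  have h : LinearMap.ker ((Q.flip x).prod (Q.flip y)) ≠ ⊥ :=
    LinearMap.ker_ne_bot_of_finrank_lt (by simp)
  obtain ⟨p, hp, hp0⟩ := (Submodule.ne_bot_iff _).mp h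
  exact ⟨p, hp0, Prod.mk_eq_zero.mp (LinearMap.mem_ker.mp hp)⟩

/-- If the line `ab` is conjugate to the line `bc`, then
`Q(b,b) Q(a,c) = Q(a,b) Q(b,c)`. -/
theorem mul_eq_mul_of_lines_conjugate {Q : LinearMap.BilinForm ℝ (Fin 3 → ℝ)}
    (hQ : Q.IsSymm) {a b c : Fin 3 → ℝ}
    (h : ∀ p : Fin 3 → ℝ, p ≠ 0 → Q p a = 0 → Q p b = 0 →
      p ∈ Submodule.span ℝ ({b, c} : Set (Fin 3 → ℝ))) :
    Q b b * Q a c = Q a b * Q b c := by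
  obtain ⟨p, hp0, hpa, hpb⟩ := exists_ne_zero_bilinForm_eq_zero Q a b
  obtain ⟨x, y, rfl⟩ := Submodule.mem_span_pair.mp (h p hp0 hpa hpb)
  simp only [map_add, map_smul, LinearMap.add_apply, LinearMap.smul_apply, smul_eq_mul] at hpa hpb
  rw [hQ.eq b a, hQ.eq c a] at hpa
  rw [hQ.eq c b] at hpb
  by_contra hne
  have hdet : Q b b * Q a c - Q a b * Q b c ≠ 0 := sub_ne_zero.mpr hne
  have hx : x = 0 := by
    refine (mul_eq_zero.mp ?_).resolve_right hdet
    linear_combination Q a c * hpb - Q b c * hpa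
  have hy : y = 0 := by
    refine (mul_eq_zero.mp ?_).resolve_right hdet
    linear_combination Q b b * hpa - Q a b * hpb
  simp [hx, hy] at hp0

/-- The Gram determinant of a pair spanning a plane on which `Q` is nondegenerate is nonzero. -/
theorem gram_det_ne_zero {Q : LinearMap.BilinForm ℝ (Fin 3 → ℝ)}
    (hQ : Q.IsSymm) {b d : Fin 3 → ℝ} (hbd : LinearIndependent ℝ ![b, d])
    (h : ∀ v ∈ Submodule.span ℝ ({b, d} : Set (Fin 3 → ℝ)),
      (∀ w ∈ Submodule.span ℝ ({b, d} : Set (Fin 3 → ℝ)), Q v w = 0) → v = 0) :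
    Q b b * Q d d - Q b d ^ 2 ≠ 0 := by
  intro hdet
  have key : ∀ x y : ℝ, x * Q b b + y * Q b d = 0 → x * Q b d + y * Q d d = 0 →
      x = 0 ∧ y = 0 := by
    intro x y h₁ h₂
    refine LinearIndependent.pair_iff.mp hbd x y
      (h _ (Submodule.mem_span_pair.mpr ⟨x, y, rfl⟩) fun w hw => ?_)
    obtain ⟨s, t, rfl⟩ := Submodule.mem_span_pair.mp hw
    simp only [map_add, map_smul, LinearMap.add_apply, LinearMap.smul_apply, smul_eq_mul]
    rw [hQ.eq d b]
    linear_combination s * h₁ + t * h₂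
  obtain ⟨hdd, hbd0⟩ := key (Q d d) (-Q b d) (by linear_combination hdet) (by ring)
  have := (key 0 1 (by linear_combination -hbd0) (by linear_combination hdd)).2
  exact one_ne_zero this

theorem projective_diametral_quadrangle_harmonic
    (Q : LinearMap.BilinForm ℝ (Fin 3 → ℝ))
    (hQsymm : Q.IsSymm) (hQnondeg : Q.Nondegenerate)
    (a b c d : Fin 3 → ℝ)
    (ha : a ≠ 0) (hb : b ≠ 0) (hc : c ≠ 0) (hd : d ≠ 0)
    (hbd : LinearIndependent ℝ ![b, d])
    (haMem : a ∉ Submodule.span ℝ ({b, d} : Set (Fin 3 → ℝ)))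
    (hcMem : c ∉ Submodule.span ℝ ({b, d} : Set (Fin 3 → ℝ)))
    (hbdNondeg : ∀ v ∈ Submodule.span ℝ ({b, d} : Set (Fin 3 → ℝ)),
      (∀ w ∈ Submodule.span ℝ ({b, d} : Set (Fin 3 → ℝ)), Q v w = 0) → v = 0)
    (hConjB : ∀ p : Fin 3 → ℝ, p ≠ 0 → Q p a = 0 → Q p b = 0 →
      p ∈ Submodule.span ℝ ({b, c} : Set (Fin 3 → ℝ)))
    (hConjD : ∀ p : Fin 3 → ℝ, p ≠ 0 → Q p a = 0 → Q p d = 0 →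
      p ∈ Submodule.span ℝ ({d, c} : Set (Fin 3 → ℝ)))
    (a' : Fin 3 → ℝ) (ha' : a' ≠ 0) (ha'b : Q a' b = 0) (ha'd : Q a' d = 0)
    (Astar : Fin 3 → ℝ) (hAstar0 : Astar ≠ 0)
    (hAstar1 : Astar ∈ Submodule.span ℝ ({a, a'} : Set (Fin 3 → ℝ)))
    (hAstar2 : Astar ∈ Submodule.span ℝ ({b, d} : Set (Fin 3 → ℝ)))
    (Cstar : Fin 3 → ℝ) (hCstar0 : Cstar ≠ 0)
    (hCstar1 : Cstar ∈ Submodule.span ℝ ({c, a'} : Set (Fin 3 → ℝ)))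
    (hCstar2 : Cstar ∈ Submodule.span ℝ ({b, d} : Set (Fin 3 → ℝ)))
    (m₁ m₂ : Fin 3 → ℝ) (hm : LinearIndependent ℝ ![m₁, m₂])
    (hm₁Mem : m₁ ∈ Submodule.span ℝ ({b, d} : Set (Fin 3 → ℝ)))
    (hm₂Mem : m₂ ∈ Submodule.span ℝ ({b, d} : Set (Fin 3 → ℝ)))
    (hmConj : Q m₁ m₂ = 0)
    (β δ β' δ' : ℝ) (hm₁ : m₁ = β • b + δ • d) (hm₂ : m₂ = β' • b + δ' • d)
    (hmHarm : β * δ' + β' * δ = 0)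
    (σ τ σ' τ' : ℝ) (hA : Astar = σ • m₁ + τ • m₂) (hC : Cstar = σ' • m₁ + τ' • m₂) :
    σ * τ' + σ' * τ = 0 := by
  have hB := mul_eq_mul_of_lines_conjugate hQsymm hConjB
  have hD := mul_eq_mul_of_lines_conjugate hQsymm hConjD
  have hdet := gram_det_ne_zero hQsymm hbd hbdNondeg
  have hdb : Q d b = Q b d := hQsymm.eq d b
  obtain ⟨x, y, hxy⟩ := Submodule.mem_span_pair.mp hAstar1
  obtain ⟨x', y', hxy'⟩ := Submodule.mem_span_pair.mp hCstar1
  have hA' : Astar = (σ * β + τ * β') • b + (σ * δ + τ * δ') • d := by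
    rw [hA, hm₁, hm₂]; module
  have hC' : Cstar = (σ' * β + τ' * β') • b + (σ' * δ + τ' * δ') • d := by
    rw [hC, hm₁, hm₂]; module
  have hbb' : Q b a' = 0 := by rw [← ha'b]; exact hQsymm.eq b a'
  have hdd' : Q d a' = 0 := by rw [← ha'd]; exact hQsymm.eq d a'
  have hAb : Q Astar b = x * Q a b := by simp [← hxy, ha'b]
  have hAd : Q Astar d = x * Q a d := by simp [← hxy, ha'd]
  have hbC : Q b Cstar = x' * Q b c := by simp [← hxy', hbb']
  have hdC : Q d Cstar = x' * Q d c := by simp [← hxy', hdd']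
  have ha'C : Q a' Cstar = 0 := by simp [hC', ha'b, ha'd]
  have hAC : Q Astar Cstar = x * (x' * Q a c + y' * Q a a') := by
    rw [← hxy, map_add, LinearMap.add_apply, map_smul, map_smul, LinearMap.smul_apply,
      LinearMap.smul_apply, ha'C, ← hxy']
    simp
  have hGramB : Q b b * Q Astar Cstar - Q Astar b * Q b Cstar
      = Q b b * (x * y' * Q a a') := by
    rw [hAC, hAb, hbC]; linear_combination x * x' * hB
  have hGramD : Q d d * Q Astar Cstar - Q Astar d * Q d Cstar
      = Q d d * (x * y' * Q a a') := by
    rw [hAC, hAd, hdC]; linear_combination x * x' * hD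
  generalize x * y' * Q a a' = κ at hGramB hGramD
  simp only [hA', hC', map_add, map_smul, LinearMap.add_apply, LinearMap.smul_apply,
    smul_eq_mul] at hGramB hGramD
  rw [hm₁, hm₂] at hmConj
  simp only [map_add, map_smul, LinearMap.add_apply, LinearMap.smul_apply,
    smul_eq_mul] at hmConj
  rw [hdb] at hGramB hGramD hmConj
  have hmdet : β * δ' - β' * δ ≠ 0 := by
    intro h0
    have h₁ : β * δ' = 0 := by linarith
    have h₂ : β' * δ = 0 := by linarith
    have hβ := LinearIndependent.pair_iff.mp hm β' (-β) (by
      rw [hm₁, hm₂]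
      match_scalars <;> linarith)
    have hδ := LinearIndependent.pair_iff.mp hm δ' (-δ) (by
      rw [hm₁, hm₂]
      match_scalars <;> linarith)
    refine hm.ne_zero 0 ?_
    simp [hm₁, neg_eq_zero.mp hβ.2, neg_eq_zero.mp hδ.2]
  have hβ'δ : β' * δ ≠ 0 := fun h0 => hmdet (by linear_combination hmHarm - 2 * h0)
  have hβδ' : β * δ' ≠ 0 := fun h0 => hmdet (by linear_combination 2 * h0 - hmHarm)
  have hβ : β ≠ 0 := left_ne_zero_of_mul hβδ'
  have hβ' : β' ≠ 0 := left_ne_zero_of_mul hβ'δ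
  have hδ : δ ≠ 0 := right_ne_zero_of_mul hβ'δ
  have hnorm : β ^ 2 * Q b b = δ ^ 2 * Q d d := by
    refine mul_left_cancel₀ hβ' ?_
    linear_combination β * hmConj - (β * Q b d + δ * Q d d) * hmHarm
  have hprod : β ^ 2 * ((σ * δ + τ * δ') * (σ' * δ + τ' * δ'))
      = δ ^ 2 * ((σ * β + τ * β') * (σ' * β + τ' * β')) := by
    refine mul_left_cancel₀ hdet ?_
    linear_combination β ^ 2 * hGramB - δ ^ 2 * hGramD + κ * hnorm
  have hne : -2 * β * β' * δ ^ 2 ≠ 0 := by simp [hβ, hβ', hδ]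
  refine (mul_eq_zero.mp ?_).resolve_left hne
  linear_combination hprod -
    (β * δ * (σ * τ' + σ' * τ) + (β * δ' - β' * δ) * τ * τ') * hmHarm
end

section
/- (Euclidean case of the diametral quadrilateral bisector theorem.) Let A, B₁, A′, D₁ be four pairwise distinct points of the Euclidean plane with ∠ A B₁ A′ = π/2 and ∠ A D₁ A′ = π/2 (a diametral quadrilateral with right angles at the opposite vertices B₁ and D₁), with B₁ ≠ D₁ and with A′ not on the line through B₁ and D₁. Let F be the orthogonal projection of A′ onto the line through B₁ and D₁. Then ∠ A A′ B₁ = ∠ F A′ D₁ or ∠ A A′ B₁ = π − ∠ F A′ D₁; that is, the pair of lines A′A and A′F has the same pair of angle bisectors as the pair of lines A′B₁ and A′D₁. -/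
open EuclideanGeometry Real

/-- In coordinates centred at a vertex of a triangle with sides `b`, `d` at that vertex, altitude
`f` and circumdiameter `a`, the product of the two sides is the circumdiameter times the
altitude. -/
lemma sq_side_mul_sq_side_eq_sq_diameter_mul_sq_altitude
    {a₀ a₁ b₀ b₁ d₀ d₁ f₀ f₁ t : ℝ}
    (hab : a₀ * b₀ + a₁ * b₁ = b₀ ^ 2 + b₁ ^ 2) (had : a₀ * d₀ + a₁ * d₁ = d₀ ^ 2 + d₁ ^ 2)
    (hf₀ : f₀ = b₀ + t * (d₀ - b₀)) (hf₁ : f₁ = b₁ + t * (d₁ - b₁))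
    (hperp : f₀ * (d₀ - b₀) + f₁ * (d₁ - b₁) = 0)
    (hbd : (d₀ - b₀) ^ 2 + (d₁ - b₁) ^ 2 ≠ 0) :
    (b₀ ^ 2 + b₁ ^ 2) * (d₀ ^ 2 + d₁ ^ 2) = (a₀ ^ 2 + a₁ ^ 2) * (f₀ ^ 2 + f₁ ^ 2) := by
  have hdet : b₀ * d₁ - b₁ * d₀ = f₀ * (d₁ - b₁) - f₁ * (d₀ - b₀) := by
    rw [hf₀, hf₁]; ring
  have harea : (b₀ * d₁ - b₁ * d₀) ^ 2
      = (f₀ ^ 2 + f₁ ^ 2) * ((d₀ - b₀) ^ 2 + (d₁ - b₁) ^ 2) := by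
    rw [hdet]
    linear_combination (-(f₀ * (d₀ - b₀) + f₁ * (d₁ - b₁))) * hperp
  have ha₀ : a₀ * (b₀ * d₁ - b₁ * d₀)
      = (b₀ ^ 2 + b₁ ^ 2) * d₁ - (d₀ ^ 2 + d₁ ^ 2) * b₁ := by
    linear_combination d₁ * hab - b₁ * had
  have ha₁ : a₁ * (b₀ * d₁ - b₁ * d₀)
      = (d₀ ^ 2 + d₁ ^ 2) * b₀ - (b₀ ^ 2 + b₁ ^ 2) * d₀ := by
    linear_combination b₀ * had - d₀ * hab
  have hdiam : (a₀ ^ 2 + a₁ ^ 2) * (b₀ * d₁ - b₁ * d₀) ^ 2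
      = (b₀ ^ 2 + b₁ ^ 2) * (d₀ ^ 2 + d₁ ^ 2) * ((d₀ - b₀) ^ 2 + (d₁ - b₁) ^ 2) := by
    calc _ = (a₀ * (b₀ * d₁ - b₁ * d₀)) ^ 2 + (a₁ * (b₀ * d₁ - b₁ * d₀)) ^ 2 := by ring
      _ = _ := by rw [ha₀, ha₁]; ring
  apply mul_right_cancel₀ hbd
  rw [← hdiam, harea]
  ring

/-- If the circumdiameter `a` and the altitude `f` of a triangle with sides `b`, `d` issue from the
same vertex, then the angle between `a` and `b` equals the angle between `f` and `d`. -/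
lemma angle_diameter_side_eq_angle_altitude_side {a b d f : EuclideanSpace ℝ (Fin 2)} {t : ℝ}
    (hb : b ≠ 0) (hd : d ≠ 0) (hf : f ≠ 0) (hbd : d - b ≠ 0)
    (hab : inner ℝ a b = inner ℝ b b) (had : inner ℝ a d = inner ℝ d d)
    (hft : f = b + t • (d - b)) (hperp : inner ℝ f (d - b) = 0) :
    InnerProductGeometry.angle a b = InnerProductGeometry.angle f d := by
  have hfd : inner ℝ f d = inner ℝ f f := by
    have hfb : inner ℝ f d = inner ℝ f b := by
      rwa [inner_sub_right, sub_eq_zero] at hperp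
    nth_rewrite 3 [hft]
    rw [inner_add_right, inner_smul_right, hperp, hfb, mul_zero, add_zero]
  have ha : a ≠ 0 := by
    rintro rfl
    rw [inner_zero_left] at hab
    exact hb (inner_self_eq_zero.mp hab.symm)
  have hsq : ‖b‖ ^ 2 * ‖d‖ ^ 2 = ‖a‖ ^ 2 * ‖f‖ ^ 2 := by
    have hbd' := pow_ne_zero 2 (norm_ne_zero_iff.mpr hbd)
    simp only [EuclideanSpace.real_norm_sq_eq, Fin.sum_univ_two, PiLp.sub_apply] at hbd' ⊢
    simp only [PiLp.inner_apply, Fin.sum_univ_two, RCLike.inner_apply, conj_trivial,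
      PiLp.sub_apply] at hab had hperp
    have hft₀ := congrArg (fun v : EuclideanSpace ℝ (Fin 2) => v 0) hft
    have hft₁ := congrArg (fun v : EuclideanSpace ℝ (Fin 2) => v 1) hft
    simp only [PiLp.add_apply, PiLp.smul_apply, PiLp.sub_apply, smul_eq_mul] at hft₀ hft₁
    exact sq_side_mul_sq_side_eq_sq_diameter_mul_sq_altitude (by linarith) (by linarith)
      hft₀ hft₁ (by linarith) hbd'
  have hmul : ‖b‖ * ‖d‖ = ‖a‖ * ‖f‖ := by
    rw [← mul_pow, ← mul_pow] at hsq
    exact (pow_left_inj₀ (by positivity) (by positivity) two_ne_zero).mp hsq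
  have ha' := norm_ne_zero_iff.mpr ha
  have hb' := norm_ne_zero_iff.mpr hb
  have hd' := norm_ne_zero_iff.mpr hd
  have hf' := norm_ne_zero_iff.mpr hf
  unfold InnerProductGeometry.angle
  rw [hab, hfd, real_inner_self_eq_norm_sq, real_inner_self_eq_norm_sq]
  congr 1
  rw [div_eq_div_iff (by positivity) (by positivity)]
  linear_combination ‖b‖ * ‖f‖ * hmul

/-- A right angle at `B` in terms of the vectors issuing from `C`. -/
lemma inner_vsub_eq_inner_self_of_angle_eq_pi_div_two
    {V P : Type*} [NormedAddCommGroup V] [InnerProductSpace ℝ V] [MetricSpace P]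
    [NormedAddTorsor V P] {A B C : P} (h : ∠ A B C = π / 2) :
    inner ℝ (A -ᵥ C) (B -ᵥ C) = inner ℝ (B -ᵥ C) (B -ᵥ C) := by
  have h' : inner ℝ (A -ᵥ B) (C -ᵥ B) = 0 :=
    InnerProductGeometry.inner_eq_zero_iff_angle_eq_pi_div_two _ _ |>.mpr h
  rw [← sub_eq_zero, ← inner_sub_left, vsub_sub_vsub_cancel_right, ← neg_vsub_eq_vsub_rev C B,
    inner_neg_right, h', neg_zero]

theorem diametral_quadrilateral_bisectors
    (A B₁ A' D₁ : EuclideanSpace ℝ (Fin 2))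
    (hAB₁ : A ≠ B₁) (hAA' : A ≠ A') (hAD₁ : A ≠ D₁)
    (hB₁A' : B₁ ≠ A') (hB₁D₁ : B₁ ≠ D₁) (hA'D₁ : A' ≠ D₁)
    (hB : ∠ A B₁ A' = π / 2) (hD : ∠ A D₁ A' = π / 2)
    (hA'line : A' ∉ affineSpan ℝ ({B₁, D₁} : Set (EuclideanSpace ℝ (Fin 2))))
    (F : EuclideanSpace ℝ (Fin 2))
    (hF : F = EuclideanGeometry.orthogonalProjection (affineSpan ℝ {B₁, D₁}) A') :
    ∠ A A' B₁ = ∠ F A' D₁ ∨ ∠ A A' B₁ = π - ∠ F A' D₁ := by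
  left
  have hFmem : F ∈ affineSpan ℝ ({B₁, D₁} : Set (EuclideanSpace ℝ (Fin 2))) :=
    hF ▸ EuclideanGeometry.orthogonalProjection_mem A'
  have hFA' : F ≠ A' := fun h => hA'line (h ▸ hFmem)
  have hperp : inner ℝ (F -ᵥ A') (D₁ -ᵥ B₁) = 0 := by
    rw [hF, real_inner_comm]
    exact Submodule.inner_right_of_mem_orthogonal
      (AffineSubspace.vsub_mem_direction (right_mem_affineSpan_pair ℝ B₁ D₁)
        (left_mem_affineSpan_pair ℝ B₁ D₁))
      (EuclideanGeometry.orthogonalProjection_vsub_mem_direction_orthogonal _ A')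
  obtain ⟨t, ht⟩ := mem_affineSpan_pair_iff_exists_lineMap_eq.mp hFmem
  have hbd : (D₁ -ᵥ A') - (B₁ -ᵥ A') = D₁ -ᵥ B₁ := vsub_sub_vsub_cancel_right _ _ _
  refine angle_diameter_side_eq_angle_altitude_side (t := t) (vsub_ne_zero.mpr hB₁A')
    (vsub_ne_zero.mpr hA'D₁.symm) (vsub_ne_zero.mpr hFA')
    (hbd ▸ vsub_ne_zero.mpr hB₁D₁.symm)
    (inner_vsub_eq_inner_self_of_angle_eq_pi_div_two hB)
    (inner_vsub_eq_inner_self_of_angle_eq_pi_div_two hD) ?_ (by rw [hbd, hperp])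
  rw [hbd, ← ht, AffineMap.lineMap_apply, vadd_vsub_assoc, add_comm]
end

section
/- Let n ≥ 1 and let A₀, A₁, …, Aₙ be the vertices of a simplex in Euclidean n-space (i.e. the points A₀, …, Aₙ are affinely independent in EuclideanSpace ℝ (Fin n)). Let C be a point such that ⟪C − Aᵢ, A₀ − Aᵢ⟫ = 0 for every i = 1, …, n (C lies on the hyperplane through Aᵢ orthogonal to the segment A₀Aᵢ, for each i). Let π₀ be the affine span of {A₁, …, Aₙ}, and let A⋆ and C⋆ be the orthogonal projections of A₀ and C onto π₀. Then the midpoint of the segment A⋆ C⋆ is the circumcenter of the face simplex with vertices A₁, …, Aₙ. -/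
open EuclideanGeometry RealInnerProductSpace

section

variable {V P : Type*} [NormedAddCommGroup V] [InnerProductSpace ℝ V] [MetricSpace P]
  [NormedAddTorsor V P]

/-- The power of `p` with respect to the sphere with diameter `a b` is `⟪a -ᵥ p, b -ᵥ p⟫`. -/
theorem dist_midpoint_sq_eq_inner_add (p a b : P) :
    dist p (midpoint ℝ a b) ^ 2 = ⟪a -ᵥ p, b -ᵥ p⟫ + dist a b ^ 2 / 4 := by
  rw [dist_comm, dist_eq_norm_vsub V, dist_eq_norm_vsub V a b, midpoint_vsub,
    ← vsub_sub_vsub_cancel_right a b p, invOf_eq_inv, ← smul_add, norm_smul, mul_pow,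
    norm_add_sq_real, norm_sub_sq_real]
  norm_num
  ring

/-- For `p` in `s`, the inner product `⟪a -ᵥ p, b -ᵥ p⟫` is the sum of the contributions along `s`
and orthogonal to `s`. -/
theorem inner_vsub_vsub_eq_orthogonalProjection_add {s : AffineSubspace ℝ P} [Nonempty s]
    [s.direction.HasOrthogonalProjection] {p : P} (hp : p ∈ s) (a b : P) :
    ⟪a -ᵥ p, b -ᵥ p⟫ =
      ⟪(orthogonalProjection s a : P) -ᵥ p, (orthogonalProjection s b : P) -ᵥ p⟫ +
        ⟪a -ᵥ (orthogonalProjection s a : P), b -ᵥ (orthogonalProjection s b : P)⟫ := by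
  have along (x : P) : (orthogonalProjection s x : P) -ᵥ p ∈ s.direction :=
    AffineSubspace.vsub_mem_direction (orthogonalProjection_mem x) hp
  have across (x : P) := vsub_orthogonalProjection_mem_direction_orthogonal s x
  rw [← vsub_add_vsub_cancel a (orthogonalProjection s a : P) p,
    ← vsub_add_vsub_cancel b (orthogonalProjection s b : P) p, inner_add_left, inner_add_right,
    inner_add_right, Submodule.inner_right_of_mem_orthogonal (along a) (across b),
    Submodule.inner_left_of_mem_orthogonal (along b) (across a)]
  ring

end

/-- Theorem: for a simplex `A 0, A 1, …, A (m+1)` in Euclidean `(m+1)`-space (so `n = m + 1 ≥ 1`),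
if `C` lies on all the hyperplanes through `A i` (`i ≥ 1`) orthogonal to `A 0 - A i`, then the
midpoint of the orthogonal projections of `A 0` and `C` onto the hyperplane `π₀` spanned by
`A 1, …, A (m+1)` is the circumcenter of the face simplex with those vertices. -/
theorem simplex_projection_midpoint_circumcenter
    (m : ℕ) (A : Fin (m + 2) → EuclideanSpace ℝ (Fin (m + 1)))
    (hA : AffineIndependent ℝ A)
    (C : EuclideanSpace ℝ (Fin (m + 1)))
    (hC : ∀ i : Fin (m + 1), ⟪C - A i.succ, A 0 - A i.succ⟫ = 0)
    (π₀ : AffineSubspace ℝ (EuclideanSpace ℝ (Fin (m + 1))))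
    (hπ₀ : π₀ = affineSpan ℝ (Set.range fun i : Fin (m + 1) => A i.succ))
    (Astar Cstar : EuclideanSpace ℝ (Fin (m + 1)))
    (hAstar : Astar = EuclideanGeometry.orthogonalProjection
      (affineSpan ℝ (Set.range fun i : Fin (m + 1) => A i.succ)) (A 0))
    (hCstar : Cstar = EuclideanGeometry.orthogonalProjection
      (affineSpan ℝ (Set.range fun i : Fin (m + 1) => A i.succ)) C)
    (S : Affine.Simplex ℝ (EuclideanSpace ℝ (Fin (m + 1))) m)
    (hS : S.points = fun i => A i.succ) :
    midpoint ℝ Astar Cstar = S.circumcenter := by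
  refine S.eq_circumcenter_of_dist_eq
    (r := √(dist Astar Cstar ^ 2 / 4 - ⟪A 0 - Astar, C - Cstar⟫)) ?_ fun i => ?_
  · rw [hS, hAstar, hCstar]
    exact AffineMap.lineMap_mem _ (orthogonalProjection_mem _) (orthogonalProjection_mem _)
  · rw [hS, ← Real.sqrt_sq dist_nonneg, dist_midpoint_sq_eq_inner_add]
    congr 1
    have hmem : A i.succ ∈ affineSpan ℝ (Set.range fun i : Fin (m + 1) => A i.succ) :=
      subset_affineSpan ℝ _ ⟨i, rfl⟩
    have h := inner_vsub_vsub_eq_orthogonalProjection_add hmem (A 0) C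
    simp only [← hAstar, ← hCstar, vsub_eq_sub] at h ⊢
    rw [real_inner_comm, hC i] at h
    linarith
end

section
/- Let A, B, C, D be four pairwise distinct points of the Euclidean plane with B, C, D affinely independent, and suppose ∠ A B C = π/2 and ∠ A D C = π/2 (the quadrilateral ABCD has right angles at the opposite vertices B and D). Let H be the orthocenter of the triangle with vertices B, C, D, and let M be the midpoint of the segment B D. Then the points A, H and M are collinear. -/
open EuclideanGeometry Real

/-- In a triangle spanning the ambient space, a point is the orthocenter as soon as it satisfies
the perpendicularity conditions of the altitudes through two distinct vertices. -/
theorem Affine.Triangle.eq_orthocenter_of_inner_eq_zero {V P : Type*} [NormedAddCommGroup V]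
    [InnerProductSpace ℝ V] [MetricSpace P] [NormedAddTorsor V P] {t : Affine.Triangle ℝ P}
    (ht : affineSpan ℝ (Set.range t.points) = ⊤) {i₁ i₂ i₃ : Fin 3} (h₁₂ : i₁ ≠ i₂)
    (h₁₃ : i₁ ≠ i₃) (h₂₃ : i₂ ≠ i₃) {p : P}
    (h₁ : inner ℝ (t.points i₂ -ᵥ t.points i₃) (p -ᵥ t.points i₁) = 0)
    (h₂ : inner ℝ (t.points i₁ -ᵥ t.points i₃) (p -ᵥ t.points i₂) = 0) :
    p = t.orthocenter := by
  have mem_altitude {i j k : Fin 3} (hij : i ≠ j) (hik : i ≠ k) (hjk : j ≠ k)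
      (h : inner ℝ (t.points j -ᵥ t.points k) (p -ᵥ t.points i) = 0) : p ∈ t.altitude i := by
    have hcompl : ({i}ᶜ : Set (Fin 3)) = {j, k} := by grind
    rw [Affine.Simplex.altitude_def, ht, inf_top_eq, AffineSubspace.mem_mk', hcompl,
      Set.image_pair, direction_affineSpan, vectorSpan_pair,
      Submodule.mem_orthogonal_singleton_iff_inner_right]
    exact h
  exact t.eq_orthocenter_of_forall_mem_altitude h₁₂ (mem_altitude h₁₂ h₁₃ h₂₃ h₁)
    (mem_altitude h₁₂.symm h₂₃ h₁₃ h₂)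

theorem diametral_quadrilateral_orthocenter_collinear
    (A B C D : EuclideanSpace ℝ (Fin 2))
    (hAB : A ≠ B) (hAC : A ≠ C) (hAD : A ≠ D) (hBC : B ≠ C) (hBD : B ≠ D) (hCD : C ≠ D)
    (T : Affine.Triangle ℝ (EuclideanSpace ℝ (Fin 2)))
    (hT : T.points = ![B, C, D])
    (hB : ∠ A B C = π / 2) (hD : ∠ A D C = π / 2)
    (H : EuclideanSpace ℝ (Fin 2)) (hH : H = T.orthocenter)
    (M : EuclideanSpace ℝ (Fin 2)) (hM : M = midpoint ℝ B D) :
    Collinear ℝ ({A, H, M} : Set (EuclideanSpace ℝ (Fin 2))) := by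
  have hspan : affineSpan ℝ (Set.range T.points) = ⊤ := by
    rw [T.independent.affineSpan_eq_top_iff_card_eq_finrank_add_one]
    simp
  rw [EuclideanGeometry.angle, ← InnerProductGeometry.inner_eq_zero_iff_angle_eq_pi_div_two,
    real_inner_comm] at hB hD
  -- The reflection of `A` in the midpoint of `BD` is the orthocenter, as `ABHD` is a parallelogram.
  have hortho : B + D - A = T.orthocenter := by
    refine Affine.Triangle.eq_orthocenter_of_inner_eq_zero hspan (i₁ := 0) (i₂ := 2) (i₃ := 1)
      (by decide) (by decide) (by decide) ?_ ?_
    · have h₁ : D - C = -(C - D) := by abel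
      have h₂ : B + D - A - B = -(A - D) := by abel
      simpa [hT, h₁, h₂, -neg_sub] using hD
    · have h₁ : B - C = -(C - B) := by abel
      have h₂ : B + D - A - D = -(A - B) := by abel
      simpa [hT, h₁, h₂, -neg_sub] using hB
  have hmid : M = midpoint ℝ A H := by
    rw [hM, hH, ← hortho, midpoint_eq_smul_add, midpoint_eq_smul_add, add_sub_cancel]
  have hcol : Collinear ℝ {M, A, H} := by
    refine collinear_insert_of_mem_affineSpan_pair ?_
    rw [hmid]
    exact AffineMap.lineMap_mem_affineSpan_pair _ _ _
  convert hcol using 1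
  grind
end
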